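/- For all abelian groups A, B and every group homomorphism r : B → A, the character complex has vanishing cohomology in every degree n ≥ 2: for every n ≥ 2 and every x ∈ C^n with d^n(x) = 0 there exists y ∈ C^{n−1} with d^{n−1}(y) = x. (This is the cohomology-vanishing statement of Lemma 3.4 of the paper for the non-constant part of the complex of units.) -/

import Mathlib

/-- The coface maps `δ_i^* : Cⁿ → Cⁿ⁺¹` of the character complex associated to
abelian groups `A`, `B` and a homomorphism `r : B → A`, where `Cⁿ = Aⁿ ⊕ B`:
`δ_0^* (φ₁,…,φₙ,ψ) = (r ψ, φ₁,…,φₙ, ψ)`;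
`δ_i^* (φ₁,…,φₙ,ψ) = (φ₁,…,φ_{i-1}, φ_i, φ_i, φ_{i+1},…,φₙ, ψ)` for `1 ≤ i ≤ n`;
`δ_{n+1}^* (φ₁,…,φₙ,ψ) = (φ₁,…,φₙ, 0, ψ)`. -/
def deltaStar {A B : Type*} [AddCommGroup A] [AddCommGroup B] (r : B →+ A)
    (n i : ℕ) (p : (Fin n → A) × B) : (Fin (n + 1) → A) × B :=
  if h0 : i = 0 then
    (Fin.cons (r p.2) p.1, p.2)
  else if hi : i ≤ n then
    ((fun k : Fin (n + 1) =>
        if hk : (k : ℕ) < i then p.1 ⟨(k : ℕ), lt_of_lt_of_le hk hi⟩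
        else p.1 ⟨(k : ℕ) - 1, by have := k.isLt; omega⟩), p.2)
  else
    (Fin.snoc p.1 0, p.2)

/-- The differential `dⁿ = Σ_{i=0}^{n+1} (−1)^i δ_i^* : Cⁿ → Cⁿ⁺¹`
of the character complex. -/
def charD {A B : Type*} [AddCommGroup A] [AddCommGroup B] (r : B →+ A) (n : ℕ)
    (p : (Fin n → A) × B) : (Fin (n + 1) → A) × B :=
  ∑ i ∈ Finset.range (n + 2), (-1 : ℤ) ^ i • deltaStar r n i p

/-- The entries `φ₁,…,φₙ` of a cochain, preceded by `r ψ` and followed by zeros. -/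
def extendedEntry {A B : Type*} [AddCommGroup A] [AddCommGroup B] (r : B →+ A)
    (n : ℕ) (p : (Fin n → A) × B) : ℕ → A
  | 0 => r p.2
  | k + 1 => if h : k < n then p.1 ⟨k, h⟩ else 0

theorem deltaStar_snd {A B : Type*} [AddCommGroup A] [AddCommGroup B] (r : B →+ A)
    (n i : ℕ) (p : (Fin n → A) × B) : (deltaStar r n i p).2 = p.2 := by
  unfold deltaStar
  split_ifs <;> rfl

theorem deltaStar_fst_apply {A B : Type*} [AddCommGroup A] [AddCommGroup B] (r : B →+ A)
    (n i : ℕ) (hin : i ≤ n + 1) (p : (Fin n → A) × B) (k : ℕ) (hk : k < n + 1) :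
    (deltaStar r n i p).1 ⟨k, hk⟩ =
      if k < i then extendedEntry r n p (k + 1) else extendedEntry r n p k := by
  unfold deltaStar
  split_ifs with h0 h1 h2 h3 h4
  · omega
  · rcases k with _ | k
    · rfl
    · have hkn : k < n := by omega
      simp only [extendedEntry, hkn, dite_true]
      rfl
  · have hkn : k < n := by omega
    simp [extendedEntry, h3, hkn]
  · rcases k with _ | k
    · omega
    · have hkn : k < n := by omega
      simp [extendedEntry, h3, hkn]
  · simp [extendedEntry, Fin.snoc]
  · omega

theorem sum_range_neg_one_pow_smul_ite {A : Type*} [AddCommGroup A] (a b : A) (k N : ℕ)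
    (h : k + 1 ≤ N) :
    ∑ i ∈ Finset.range N, (-1 : ℤ) ^ i • (if k < i then a else b) =
      (if Even k then b - a else 0) + if Even N then 0 else a := by
  induction N, h using Nat.le_induction with
  | base =>
    have hlow : ∀ i ∈ Finset.range (k + 1),
        (-1 : ℤ) ^ i • (if k < i then a else b) = (-1 : ℤ) ^ i • b := by
      intro i hi
      have := Finset.mem_range.mp hi
      rw [if_neg (by omega)]
    rw [Finset.sum_congr rfl hlow, ← Finset.sum_smul, neg_one_geom_sum]
    by_cases hk : Even k <;> simp [hk, Nat.even_add_one]
  | succ N hN ih =>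
    rw [Finset.sum_range_succ, ih, if_pos (show k < N by omega)]
    by_cases hNe : Even N
    · simp [hNe, Nat.even_add_one]
    · simp [hNe, Nat.even_add_one, (Nat.not_even_iff_odd.mp hNe).neg_one_pow]

theorem charD_snd {A B : Type*} [AddCommGroup A] [AddCommGroup B] (r : B →+ A)
    (n : ℕ) (p : (Fin n → A) × B) :
    (charD r n p).2 = if Even n then 0 else p.2 := by
  simp only [charD, Prod.snd_sum, Prod.smul_snd, deltaStar_snd]
  rw [← Finset.sum_smul, neg_one_geom_sum]
  by_cases hn : Even n <;> simp [hn, Nat.even_add]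

theorem charD_fst_apply {A B : Type*} [AddCommGroup A] [AddCommGroup B] (r : B →+ A)
    (n : ℕ) (p : (Fin n → A) × B) (k : ℕ) (hk : k < n + 1) :
    (charD r n p).1 ⟨k, hk⟩ =
      (if Even k then extendedEntry r n p k - extendedEntry r n p (k + 1) else 0) +
        if Even n then 0 else extendedEntry r n p (k + 1) := by
  have hsum := sum_range_neg_one_pow_smul_ite (extendedEntry r n p (k + 1))
    (extendedEntry r n p k) k (n + 2) (by omega)
  have hparity : Even (n + 2) ↔ Even n := by simp [Nat.even_add]
  simp only [hparity] at hsum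
  rw [← hsum]
  simp only [charD, Prod.fst_sum, Prod.smul_fst, Finset.sum_apply, Pi.smul_apply]
  refine Finset.sum_congr rfl fun i hi => ?_
  rw [deltaStar_fst_apply r n i (by have := Finset.mem_range.mp hi; omega)]

/-- For all abelian groups `A`, `B` and every group homomorphism `r : B → A`, the
character complex has vanishing cohomology in every degree `n ≥ 2` (here `n = m + 2`):
for every `x ∈ Cⁿ` with `dⁿ x = 0` there exists `y ∈ Cⁿ⁻¹` with `dⁿ⁻¹ y = x`. -/
theorem charD_exact {A B : Type*} [AddCommGroup A] [AddCommGroup B] (r : B →+ A)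
    (m : ℕ) (x : (Fin (m + 2) → A) × B) (hx : charD r (m + 2) x = 0) :
    ∃ y : (Fin (m + 1) → A) × B, charD r (m + 1) y = x := by
  have hsnd : (if Even (m + 2) then 0 else x.2) = 0 := by
    rw [← charD_snd r (m + 2) x, hx]; rfl
  have hfst : ∀ k, k < m + 3 → _ = (0 : A) := fun k hk =>
    (charD_fst_apply r (m + 2) x k hk).symm.trans (by rw [hx]; rfl)
  have hparity : Even (m + 2) ↔ Even m := by simp [Nat.even_add]
  simp only [hparity] at hsnd hfst
  by_cases hm : Even m
  · simp only [hm, if_true, add_zero] at hfst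
    refine ⟨(fun j => x.1 j.castSucc, x.2), Prod.ext (funext fun ⟨k, hk⟩ => ?_) ?_⟩
    · rw [charD_fst_apply]
      by_cases hke : Even k
      · have h := hfst k (by omega)
        rcases k with _ | k
        · simpa [Nat.even_add_one, hm, extendedEntry, sub_eq_zero] using h
        · have hk1 : k < m + 1 := by omega
          have hk2 : k < m + 2 := by omega
          simpa [Nat.even_add_one, hm, hke, extendedEntry, sub_eq_zero, hk, hk1, hk2] using h
      · by_cases hkm : k < m + 1
        · simp [Nat.even_add_one, hm, hke, extendedEntry, hkm]
        · obtain rfl : k = m + 1 := by omega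
          have h := hfst (m + 2) (by omega)
          simp [Nat.even_add, hm, extendedEntry] at h
          simp [Nat.even_add_one, hm, extendedEntry, h]
    · rw [charD_snd]
      simp [Nat.even_add_one, hm]
  · simp only [hm, if_false] at hsnd hfst
    have hodd : ∀ k (hk : k < m + 2), ¬ Even k → x.1 ⟨k, hk⟩ = 0 := by
      intro k hk hke
      simpa [hke, extendedEntry, hk] using hfst k (by omega)
    refine ⟨(fun j => if Even (j : ℕ) then -x.1 j.castSucc
      else if (j : ℕ) = m then x.1 (Fin.last (m + 1)) else 0, 0),
      Prod.ext (funext fun ⟨k, hk⟩ => ?_) ?_⟩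
    · rw [charD_fst_apply]
      by_cases hke : Even k
      · rcases k with _ | k
        · simp [Nat.even_add_one, hm, extendedEntry]
        · have hko : ¬ Even k := by simpa [Nat.even_add_one] using hke
          have hk1 : k < m + 1 := by omega
          by_cases hkm : k = m
          · subst hkm
            simp [Nat.even_add_one, hm, extendedEntry, Fin.last]
          · have hk2 : k < m := by omega
            simp [Nat.even_add_one, hm, hko, extendedEntry, hk1, hk2, hkm]
      · simp [Nat.even_add_one, hm, hke, hodd k hk hke]
    · rw [charD_snd, hsnd]
      simp
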